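/- For all n ≥ 1, depth R/(I+J)^n ≥ min_{i ∈ [1,n−1], j ∈ [1,n]} { depth A/I^{n−i} + depth B/J^i + 1 , depth A/I^{n−j+1} + depth B/J^j }, where the minimum is taken over both families of expressions (the first family being empty when n = 1). -/

import Mathlib

/-! Core definitions: depth via local cohomology at the maximal homogeneous ideal,
Castelnuovo–Mumford regularity via graded free resolutions, gradings on
subquotients of polynomial rings.  -/

open MvPolynomial

noncomputable section

namespace PaperHTT

variable (k : Type) [Field k]

/-- A polynomial is homogeneous of degree `e : ℤ` (it must vanish in negative degrees). -/
def homogZ {σ : Type} (p : MvPolynomial σ k) (e : ℤ) : Prop :=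
  p = 0 ∨ (0 ≤ e ∧ p.IsHomogeneous e.toNat)

/-- The maximal homogeneous ideal `(x_1, …, x_r)` of a polynomial ring. -/
def maxHomIdeal (σ : Type) : Ideal (MvPolynomial σ k) :=
  Ideal.span (Set.range MvPolynomial.X)

/-- The depth of a module over a polynomial ring with respect to the maximal homogeneous
ideal: the least `i` such that the `i`-th local cohomology is non-vanishing. -/
def depthM {σ : Type} (M : ModuleCat (MvPolynomial σ k)) : ℕ :=
  sInf {i : ℕ | Nontrivial ((localCohomology (maxHomIdeal k σ) i).obj M)}

/-- The subquotient `p/q` of a polynomial ring, for ideals `q ≤ p`. -/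
abbrev subQuot {σ : Type} (p q : Ideal (MvPolynomial σ k)) : Type :=
  ↥p ⧸ (Submodule.comap p.subtype q)

/-- The degree-`t` graded piece of `p/q`: the image of the homogeneous elements of
degree `t` of `p`. -/
def subQuotGr {σ : Type} (p q : Ideal (MvPolynomial σ k)) (t : ℤ) :
    AddSubgroup (subQuot k p q) :=
  AddSubgroup.closure
    {x | ∃ f : p, homogZ k (f : MvPolynomial σ k) t ∧ x = Submodule.Quotient.mk f}

/-- The degree-`t` graded piece of the quotient ring `P/Q`. -/
def quotGr {σ : Type} (Q : Ideal (MvPolynomial σ k)) (t : ℤ) :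
    AddSubgroup (MvPolynomial σ k ⧸ Q) :=
  AddSubgroup.closure {x | ∃ f, homogZ k f t ∧ x = Ideal.Quotient.mk Q f}

/-- The degree-`t` graded piece of an ideal `p`, viewed as a module. -/
def idealGr {σ : Type} (p : Ideal (MvPolynomial σ k)) (t : ℤ) : AddSubgroup ↥p :=
  AddSubgroup.closure {x : p | homogZ k (x : MvPolynomial σ k) t}

/-- A finite graded free resolution of a module `M` over a polynomial ring,
with respect to a grading `gr` of `M`: `F_i` is free of rank `rk i`, with basis elements
of (twisted) degrees `tw i l`, the differentials and augmentation are graded of degree `0`,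
and the complex `⋯ → F_1 → F_0 → M → 0` is exact. -/
structure GradedFreeRes (σ : Type) (M : Type) [AddCommGroup M]
    [Module (MvPolynomial σ k) M] (gr : ℤ → AddSubgroup M) where
  rk : ℕ → ℕ
  tw : (i : ℕ) → Fin (rk i) → ℤ
  bdd : ∃ N, ∀ i, N ≤ i → rk i = 0
  aug : (Fin (rk 0) → MvPolynomial σ k) →ₗ[MvPolynomial σ k] M
  d : (i : ℕ) →
    ((Fin (rk (i + 1)) → MvPolynomial σ k) →ₗ[MvPolynomial σ k]
      (Fin (rk i) → MvPolynomial σ k))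
  aug_surj : Function.Surjective aug
  exact_zero : LinearMap.range (d 0) = LinearMap.ker aug
  exact_succ : ∀ i, LinearMap.range (d (i + 1)) = LinearMap.ker (d i)
  aug_homog : ∀ l, aug (Pi.single l 1) ∈ gr (tw 0 l)
  d_homog : ∀ i l l', homogZ k (d i (Pi.single l 1) l') (tw (i + 1) l - tw i l')

/-- The Castelnuovo–Mumford regularity of a (finitely generated) graded module over a
polynomial ring: the least `r` such that `M` admits a graded free resolution with all
twists in homological degree `i` at most `r + i`.  (By minimal free resolutions, this
agrees with `max {aⁱ(M) + i}`.) -/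
def regM (σ : Type) (M : Type) [AddCommGroup M] [Module (MvPolynomial σ k) M]
    (gr : ℤ → AddSubgroup M) : ℤ :=
  sInf {r : ℤ | ∃ F : GradedFreeRes k σ M gr, ∀ i (l : Fin (F.rk i)), F.tw i l - (i : ℤ) ≤ r}

/-- Depth of the quotient ring `P/Q` as a module over `P`. -/
def depthQuot {σ : Type} (Q : Ideal (MvPolynomial σ k)) : ℕ :=
  depthM k (ModuleCat.of (MvPolynomial σ k) (MvPolynomial σ k ⧸ Q))

/-- Depth of the subquotient `p/q` as a module over the polynomial ring. -/
def depthSubQuot {σ : Type} (p q : Ideal (MvPolynomial σ k)) : ℕ :=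
  depthM k (ModuleCat.of (MvPolynomial σ k) (subQuot k p q))

/-- Depth of an ideal `p` as a module over the polynomial ring. -/
def depthIdeal {σ : Type} (p : Ideal (MvPolynomial σ k)) : ℕ :=
  depthM k (ModuleCat.of (MvPolynomial σ k) ↥p)

/-- Regularity of the quotient ring `P/Q`. -/
def regQuot {σ : Type} (Q : Ideal (MvPolynomial σ k)) : ℤ :=
  regM k σ (MvPolynomial σ k ⧸ Q) (quotGr k Q)

/-- Regularity of the subquotient `p/q`. -/
def regSubQuot {σ : Type} (p q : Ideal (MvPolynomial σ k)) : ℤ :=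
  regM k σ (subQuot k p q) (subQuotGr k p q)

/-- Regularity of an ideal `p`, viewed as a graded module. -/
def regIdeal {σ : Type} (p : Ideal (MvPolynomial σ k)) : ℤ :=
  regM k σ (↥p) (idealGr k p)

/-- A homogeneous ideal: one containing all homogeneous components of its elements. -/
def IsHomogeneousIdeal {σ : Type} (I : Ideal (MvPolynomial σ k)) : Prop :=
  ∀ f ∈ I, ∀ m : ℕ, MvPolynomial.homogeneousComponent m f ∈ I

/-- A monomial ideal. -/
def IsMonomialIdeal {σ : Type} (I : Ideal (MvPolynomial σ k)) : Prop :=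
  ∃ S : Set (σ →₀ ℕ), I = Ideal.span ((fun a => MvPolynomial.monomial a (1 : k)) '' S)

/-- A squarefree monomial ideal. -/
def IsSquarefreeMonomialIdeal {σ : Type} (I : Ideal (MvPolynomial σ k)) : Prop :=
  ∃ S : Set (σ →₀ ℕ), (∀ a ∈ S, ∀ x, a x ≤ 1) ∧
    I = Ideal.span ((fun a => MvPolynomial.monomial a (1 : k)) '' S)


/-- The quotient ring `P/Q` is Cohen–Macaulay: its depth equals its Krull dimension. -/
def IsCMQuot {σ : Type} (Q : Ideal (MvPolynomial σ k)) : Prop :=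
  (depthQuot k Q : WithBot (WithTop ℕ)) = ringKrullDim (MvPolynomial σ k ⧸ Q)

/-- An isomorphism of graded modules: a linear isomorphism matching up the gradings. -/
def GradedIso {P : Type} [CommRing P] {M N : Type} [AddCommGroup M] [Module P M]
    [AddCommGroup N] [Module P N] (grM : ℤ → AddSubgroup M) (grN : ℤ → AddSubgroup N) :
    Prop :=
  ∃ e : M ≃ₗ[P] N, ∀ t, (grM t).map e.toLinearMap.toAddMonoidHom = grN t

/-- `gr` is an (internal, ℤ-) grading of the module `M` over a polynomial ring,
compatible with the standard grading of the polynomial ring. -/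
def IsGrading (σ : Type) {M : Type} [AddCommGroup M] [Module (MvPolynomial σ k) M]
    (gr : ℤ → AddSubgroup M) : Prop :=
  DirectSum.IsInternal (fun t : ℤ => gr t) ∧
    ∀ (p : MvPolynomial σ k) (d : ℕ) (t : ℤ) (m : M), p.IsHomogeneous d → m ∈ gr t →
      p • m ∈ gr (t + d)

/-- The polynomial ring `A = k[x_1,…,x_r]`. -/
abbrev PA (r : ℕ) : Type := MvPolynomial (Fin r) k

/-- The polynomial ring `B = k[y_1,…,y_s]`. -/
abbrev PB (s : ℕ) : Type := MvPolynomial (Fin s) k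

/-- The polynomial ring `R = k[x_1,…,x_r,y_1,…,y_s]`. -/
abbrev PR (r s : ℕ) : Type := MvPolynomial (Fin r ⊕ Fin s) k

/-- The extension of an ideal `I ⊆ A` to `R`. -/
def extA {r s : ℕ} (I : Ideal (PA k r)) : Ideal (PR k r s) :=
  I.map (MvPolynomial.rename (Sum.inl : Fin r → Fin r ⊕ Fin s))

/-- The extension of an ideal `J ⊆ B` to `R`. -/
def extB {r s : ℕ} (J : Ideal (PB k s)) : Ideal (PR k r s) :=
  J.map (MvPolynomial.rename (Sum.inr : Fin s → Fin r ⊕ Fin s))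

/-- The ideal `I + J ⊆ R`. -/
def sumIJ {r s : ℕ} (I : Ideal (PA k r)) (J : Ideal (PB k s)) : Ideal (PR k r s) :=
  extA k I + extB k J

end PaperHTT

end

universe u

namespace PaperHTT

section ExtVanishing

open CategoryTheory Abelian

variable {S : Type u} [CommRing S]

/-- `Ext^i(N, M) = 0` for all `i < n`. -/
def ExtVanishBelow (N M : ModuleCat.{u} S) (n : ℕ) : Prop :=
  ∀ i < n, Subsingleton (Ext N M i)

lemma subsingleton_of_exact {S : ShortComplex AddCommGrpCat.{u}} (hS : S.Exact)
    (h₁ : Subsingleton S.X₁) (h₃ : Subsingleton S.X₃) : Subsingleton S.X₂ :=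
  AddCommGrpCat.subsingleton_of_isZero <| hS.isZero_of_both_zeros
    ((AddCommGrpCat.isZero_of_iff_subsingleton.mpr h₁).eq_zero_of_src _)
    ((AddCommGrpCat.isZero_of_iff_subsingleton.mpr h₃).eq_zero_of_tgt _)

variable {N : ModuleCat.{u} S} {C : ShortComplex (ModuleCat.{u} S)} {n : ℕ}

lemma ExtVanishBelow.mono {M : ModuleCat.{u} S} {m : ℕ} (h : ExtVanishBelow N M n)
    (hmn : m ≤ n) : ExtVanishBelow N M m :=
  fun i hi => h i (hi.trans_le hmn)

lemma ExtVanishBelow.middle (hC : C.ShortExact) (h₁ : ExtVanishBelow N C.X₁ n)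
    (h₃ : ExtVanishBelow N C.X₃ n) : ExtVanishBelow N C.X₂ n := fun i hi =>
  subsingleton_of_exact (Ext.covariant_sequence_exact₂' N hC i) (h₁ i hi) (h₃ i hi)

lemma ExtVanishBelow.right (hC : C.ShortExact) (h₁ : ExtVanishBelow N C.X₁ (n + 1))
    (h₂ : ExtVanishBelow N C.X₂ n) : ExtVanishBelow N C.X₃ n := fun i hi =>
  subsingleton_of_exact (Ext.covariant_sequence_exact₃' N hC i (i + 1) rfl) (h₂ i hi)
    (h₁ (i + 1) (by omega))

lemma ExtVanishBelow.left (hC : C.ShortExact) (h₂ : ExtVanishBelow N C.X₂ n)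
    (h₃ : ExtVanishBelow N C.X₃ (n - 1)) : ExtVanishBelow N C.X₁ n := by
  intro i hi
  cases i with
  | zero =>
    have := h₂ 0 hi
    have h2 : Subsingleton (N ⟶ C.X₂) := Ext.addEquiv₀.symm.subsingleton
    refine (Ext.addEquiv₀.subsingleton_congr).2 ⟨fun f g => ?_⟩
    have := hC.mono_f
    exact (cancel_mono C.f).1 (Subsingleton.elim _ _)
  | succ i =>
    exact subsingleton_of_exact (Ext.covariant_sequence_exact₁' N hC i (i + 1) rfl)
      (h₃ i (by omega)) (h₂ (i + 1) hi)

/-- The cyclic module `S ⧸ I` as an object of the category of modules. -/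
abbrev cyclic (I : Ideal S) : ModuleCat.{u} S := ModuleCat.of S (S ⧸ I)

/-- The complex `S ⧸ I → S ⧸ I → S ⧸ (I + (x))` whose first map is multiplication by `x`. -/
def mulComplex (I : Ideal S) (x : S) : ShortComplex (ModuleCat.{u} S) where
  X₁ := cyclic I
  X₂ := cyclic I
  X₃ := cyclic (I ⊔ Ideal.span {x})
  f := x • 𝟙 _
  g := ModuleCat.ofHom (Submodule.factor le_sup_left)
  zero := by
    refine ModuleCat.hom_ext (LinearMap.ext fun a => ?_)
    obtain ⟨a, rfl⟩ := Submodule.Quotient.mk_surjective _ a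
    refine (Submodule.Quotient.mk_eq_zero _).2 ?_
    exact Ideal.mem_sup_right (Ideal.mul_mem_right _ _ (Ideal.mem_span_singleton_self x))

lemma mulComplex_shortExact {I : Ideal S} {x : S} (hx : ∀ f, x * f ∈ I → f ∈ I) :
    (mulComplex I x).ShortExact where
  exact := by
    refine (ShortComplex.moduleCat_exact_iff _).2 fun a ha => ?_
    obtain ⟨a, rfl⟩ := Submodule.Quotient.mk_surjective _ a
    obtain ⟨i, hi, y, hy, rfl⟩ := Submodule.mem_sup.1 ((Submodule.Quotient.mk_eq_zero _).1 ha)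
    obtain ⟨z, rfl⟩ := Ideal.mem_span_singleton'.1 hy
    refine ⟨Submodule.Quotient.mk z, ((Submodule.Quotient.eq I).2 ?_)⟩
    change x * z - (i + z * x) ∈ I
    rw [mul_comm x z, sub_add_cancel_right]
    exact I.neg_mem hi
  mono_f := by
    refine (ModuleCat.mono_iff_injective _).2 ((injective_iff_map_eq_zero _).2 fun a ha => ?_)
    obtain ⟨a, rfl⟩ := Submodule.Quotient.mk_surjective _ a
    exact (Submodule.Quotient.mk_eq_zero _).2 (hx a ((Submodule.Quotient.mk_eq_zero _).1 ha))
  epi_g := (ModuleCat.epi_iff_surjective _).2 (Submodule.factor_surjective le_sup_left)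

/-- `HasRegSeq 𝔪 n I` says that `S ⧸ I` admits a weakly regular sequence of length `n` whose
entries belong to `𝔪`. -/
def HasRegSeq (𝔪 : Ideal S) : ℕ → Ideal S → Prop
  | 0, _ => True
  | n + 1, I => ∃ x ∈ 𝔪, (∀ f, x * f ∈ I → f ∈ I) ∧ HasRegSeq 𝔪 n (I ⊔ Ideal.span {x})

lemma HasRegSeq.extVanishBelow {𝔪 : Ideal S} {n : ℕ} {I : Ideal S} (h : HasRegSeq 𝔪 n I)
    {N : ModuleCat.{u} S} {t : ℕ} (ht : 𝔪 ^ t ≤ Module.annihilator S N) :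
    ExtVanishBelow N (cyclic I) n := by
  induction n generalizing I with
  | zero => intro i hi; omega
  | succ n ih =>
    obtain ⟨x, hxm, hx, h⟩ := h
    have hann : x ^ t ∈ Module.annihilator S N := ht (Ideal.pow_mem_pow hxm t)
    intro i hi
    have mono : Mono (AddCommGrpCat.ofHom
        ((Ext.mk₀ (mulComplex I x).f).postcomp N (add_zero i))) := by
      cases i with
      | zero =>
        refine (AddCommGrpCat.mono_iff_injective _).2 ?_
        have := (mulComplex_shortExact hx).mono_f
        exact Ext.postcomp_mk₀_injective_of_mono _ _
      | succ i =>
        exact (Ext.covariant_sequence_exact₁' N (mulComplex_shortExact hx) i (i + 1) rfl).mono_g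
          ((AddCommGrpCat.isZero_of_iff_subsingleton.mpr
            (ih h i (by omega))).eq_zero_of_src _)
    have mono' := ((Ext.postcomp_smul_id_mono_iff x i).mp mono).pow t
    have zero := Ext.postcomp_smul_id_eq_zero_of_mem_annihilator (M := cyclic I) hann i
    exact AddCommGrpCat.subsingleton_of_isZero
      (@Limits.IsZero.of_mono_eq_zero _ _ _ _ _ _
        ((Ext.postcomp_smul_id_mono_iff _ i).mpr mono') zero)

lemma hasRegSeq_of_extVanishBelow [IsNoetherianRing S] {𝔪 : Ideal S} {n : ℕ} {I : Ideal S}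
    (h : ExtVanishBelow (cyclic 𝔪) (cyclic I) n) : HasRegSeq 𝔪 n I := by
  induction n generalizing I with
  | zero => trivial
  | succ n ih =>
    have := h 0 n.succ_pos
    have : Subsingleton ((S ⧸ 𝔪) →ₗ[S] (S ⧸ I)) :=
      (Ext.addEquiv₀.trans (ModuleCat.homAddEquiv (M := cyclic 𝔪) (N := cyclic I))
        ).symm.subsingleton
    obtain ⟨x, hxm, hx⟩ := IsSMulRegular.subsingleton_linearMap_iff.1 this
    rw [Ideal.annihilator_quotient] at hxm
    have hx' : ∀ f, x * f ∈ I → f ∈ I := fun f hf =>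
      (Submodule.Quotient.mk_eq_zero I).1
        (hx.right_eq_zero_of_smul ((Submodule.Quotient.mk_eq_zero I).2 hf))
    exact ⟨x, hxm, hx', ih (.right (mulComplex_shortExact hx') h (h.mono n.le_succ))⟩

lemma HasRegSeq.mono {𝔪 : Ideal S} {m n : ℕ} {I : Ideal S} (h : HasRegSeq 𝔪 n I) (hmn : m ≤ n) :
    HasRegSeq 𝔪 m I := by
  induction m generalizing n I with
  | zero => trivial
  | succ m ih =>
    obtain ⟨n, rfl⟩ := Nat.exists_eq_add_of_lt hmn
    obtain ⟨x, hxm, hx, h⟩ := h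
    exact ⟨x, hxm, hx, ih h (by omega)⟩

lemma hasRegSeq_iff_extVanishBelow [IsNoetherianRing S] {𝔪 : Ideal S} {n : ℕ} {I : Ideal S} :
    HasRegSeq 𝔪 n I ↔ ExtVanishBelow (cyclic 𝔪) (cyclic I) n :=
  ⟨fun h => h.extVanishBelow (t := 1) (by simp [Ideal.annihilator_quotient]),
    hasRegSeq_of_extVanishBelow⟩

/-- The split complex `S ⧸ I → S ⧸ I × S ⧸ J → S ⧸ J`. -/
def prodComplex (I J : Ideal S) : ShortComplex (ModuleCat.{u} S) where
  X₁ := cyclic I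
  X₂ := ModuleCat.of S ((S ⧸ I) × (S ⧸ J))
  X₃ := cyclic J
  f := ModuleCat.ofHom (LinearMap.inl S _ _)
  g := ModuleCat.ofHom (LinearMap.snd S _ _)
  zero := rfl

lemma prodComplex_shortExact (I J : Ideal S) : (prodComplex I J).ShortExact where
  exact := (ShortComplex.moduleCat_exact_iff _).2 fun a ha => ⟨a.1, Prod.ext rfl (Eq.symm ha)⟩
  mono_f := (ModuleCat.mono_iff_injective _).2 fun _ _ h => congrArg Prod.fst h
  epi_g := (ModuleCat.epi_iff_surjective _).2 fun b => ⟨(0, b), rfl⟩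

lemma ExtVanishBelow.prod {I J : Ideal S} (hI : ExtVanishBelow N (cyclic I) n)
    (hJ : ExtVanishBelow N (cyclic J) n) :
    ExtVanishBelow N (ModuleCat.of S ((S ⧸ I) × (S ⧸ J))) n :=
  .middle (prodComplex_shortExact I J) hI hJ

/-- The Mayer–Vietoris complex `S ⧸ (I ∩ J) → S ⧸ I × S ⧸ J → S ⧸ (I + J)`. -/
def mayerVietorisComplex (I J : Ideal S) : ShortComplex (ModuleCat.{u} S) where
  X₁ := cyclic (I ⊓ J)
  X₂ := ModuleCat.of S ((S ⧸ I) × (S ⧸ J))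
  X₃ := cyclic (I ⊔ J)
  f := ModuleCat.ofHom ((Submodule.factor inf_le_left).prod (Submodule.factor inf_le_right))
  g := ModuleCat.ofHom ((Submodule.factor le_sup_left).comp (LinearMap.fst S _ _) -
    (Submodule.factor le_sup_right).comp (LinearMap.snd S _ _))
  zero := by
    refine ModuleCat.hom_ext (LinearMap.ext fun a => ?_)
    obtain ⟨a, rfl⟩ := Submodule.Quotient.mk_surjective _ a
    exact sub_self (Submodule.Quotient.mk a : S ⧸ (I ⊔ J))

lemma mayerVietorisComplex_shortExact (I J : Ideal S) :
    (mayerVietorisComplex I J).ShortExact where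
  exact := by
    refine (ShortComplex.moduleCat_exact_iff _).2 fun a ha => ?_
    obtain ⟨a, b⟩ := a
    obtain ⟨a, rfl⟩ := Submodule.Quotient.mk_surjective _ a
    obtain ⟨b, rfl⟩ := Submodule.Quotient.mk_surjective _ b
    have hab : a - b ∈ I ⊔ J := (Submodule.Quotient.eq _).1 (sub_eq_zero.1 ha)
    obtain ⟨i, hi, j, hj, hij⟩ := Submodule.mem_sup.1 hab
    refine ⟨Submodule.Quotient.mk (a - i), Prod.ext ?_ ?_⟩
    · exact (Submodule.Quotient.eq I).2 (by simpa using hi)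
    · refine (Submodule.Quotient.eq J).2 ?_
      change a - i - b ∈ J
      rwa [show a - i - b = j by rw [sub_right_comm, ← hij, add_sub_cancel_left]]
  mono_f := by
    refine (ModuleCat.mono_iff_injective _).2 ((injective_iff_map_eq_zero _).2 fun a ha => ?_)
    obtain ⟨a, rfl⟩ := Submodule.Quotient.mk_surjective _ a
    exact (Submodule.Quotient.mk_eq_zero _).2
      ⟨(Submodule.Quotient.mk_eq_zero I).1 (congrArg Prod.fst ha),
        (Submodule.Quotient.mk_eq_zero J).1 (congrArg Prod.snd ha)⟩
  epi_g := (ModuleCat.epi_iff_surjective _).2 fun a => by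
    obtain ⟨a, rfl⟩ := Submodule.Quotient.mk_surjective _ a
    exact ⟨(Submodule.Quotient.mk a, 0), sub_zero (Submodule.Quotient.mk a : S ⧸ (I ⊔ J))⟩

variable [IsNoetherianRing S] {𝔪 I J : Ideal S}

lemma HasRegSeq.sup (h : HasRegSeq 𝔪 (n + 1) (I ⊓ J)) (hI : HasRegSeq 𝔪 n I)
    (hJ : HasRegSeq 𝔪 n J) : HasRegSeq 𝔪 n (I ⊔ J) := by
  rw [hasRegSeq_iff_extVanishBelow] at *
  exact .right (mayerVietorisComplex_shortExact I J) h
    (hI.prod hJ)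

lemma HasRegSeq.inf (h : HasRegSeq 𝔪 (n - 1) (I ⊔ J)) (hI : HasRegSeq 𝔪 n I)
    (hJ : HasRegSeq 𝔪 n J) : HasRegSeq 𝔪 n (I ⊓ J) := by
  rw [hasRegSeq_iff_extVanishBelow] at *
  exact .left (mayerVietorisComplex_shortExact I J)
    (hI.prod hJ) h

end ExtVanishing
section LocalCohomology

open CategoryTheory Abelian Opposite

lemma mono_homologyMap_of_forall {R : Type u} [Ring R] {S₁ S₂ : ShortComplex (ModuleCat.{u} R)}
    (φ : S₁ ⟶ S₂)
    (h : ∀ x : S₁.X₂, S₁.g x = 0 → (∃ y, S₂.f y = φ.τ₂ x) → ∃ z, S₁.f z = x) :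
    Mono (ShortComplex.homologyMap φ) := by
  rw [ShortComplex.mono_homologyMap_iff_up_to_refinements]
  intro A x hx y hxy
  have key : ∀ a : A, ∃ z, S₁.f z = x a := fun a ↦ by
    refine h _ ?_ ⟨y a, ?_⟩
    · simpa using ConcreteCategory.congr_hom hx a
    · simpa using (ConcreteCategory.congr_hom hxy a).symm
  let L : Submodule R (A × S₁.X₁) :=
    LinearMap.ker (x.hom.comp (LinearMap.fst R A S₁.X₁) - S₁.f.hom.comp (LinearMap.snd R A S₁.X₁))
  refine ⟨ModuleCat.of R L, ModuleCat.ofHom ((LinearMap.fst R A S₁.X₁).comp L.subtype), ?_,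
    ModuleCat.ofHom ((LinearMap.snd R A S₁.X₁).comp L.subtype), ?_⟩
  · rw [ModuleCat.epi_iff_surjective]
    intro a
    obtain ⟨z, hz⟩ := key a
    exact ⟨⟨(a, z), by rw [LinearMap.mem_ker]; exact sub_eq_zero.2 hz.symm⟩, rfl⟩
  · ext ⟨⟨a, z⟩, haz⟩
    exact sub_eq_zero.1 (LinearMap.mem_ker.1 haz)

section

variable {S : Type u} [CommRing S] {X Y M : ModuleCat.{u} S}

lemma extMk_eq_zero_iff_next (P : ProjectiveResolution X) {n : ℕ} (f : P.complex.X n ⟶ M) (m : ℕ)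
    (hm : n + 1 = m) (hf : P.complex.d m n ≫ f = 0) :
    P.extMk f m hm hf = 0 ↔
      ∃ g : P.complex.X ((ComplexShape.down ℕ).next n) ⟶ M, P.complex.d n _ ≫ g = f := by
  obtain _ | p := n
  · have h0 : P.complex.d 0 ((ComplexShape.down ℕ).next 0) = 0 :=
      P.complex.shape _ _ (by simp)
    simp only [h0, Limits.zero_comp, exists_const]
    refine ⟨fun h ↦ ?_, fun h ↦ by subst h; exact P.extMk_zero m hm⟩
    simp only [← P.extEquivCohomologyClass.apply_eq_iff_eq,
      P.extEquivCohomologyClass_extMk, P.extEquivCohomologyClass_zero,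
      CochainComplex.HomComplex.CohomologyClass.mk_eq_zero_iff] at h
    rw [CochainComplex.HomComplex.Cocycle.toSingleMk_mem_coboundaries_iff _ _ _ _ _ 1
      (by simp)] at h
    obtain ⟨g, hg⟩ := h
    have hz : Limits.IsZero (P.cochainComplex.X 1) :=
      P.cochainComplex.isZero_of_isStrictlyLE 0 1 (by simp)
    rw [hz.eq_of_tgt (P.cochainComplex.d _ _) 0, Limits.zero_comp] at hg
    rw [← cancel_epi (P.cochainComplexXIso (-(0 : ℕ)) 0 rfl).hom, ← hg, Limits.comp_zero]
  · rw [P.extMk_eq_zero_iff f m hm hf p rfl, ChainComplex.next_nat_succ]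

variable (M) in
/-- The degree `n` part of the complex computing `Ext^n(X, M)` from a resolution of `X`. -/
noncomputable def homShortComplex (P : ProjectiveResolution X) (n : ℕ) :
    ShortComplex (ModuleCat.{u} S) :=
  (((((linearYoneda S (ModuleCat.{u} S)).obj M).rightOp.mapHomologicalComplex _).obj
    P.complex).sc n).unop

/-- The functor `_root_.Ext`, defined by deriving the Hom functor on the left, computed from a
projective resolution. -/
noncomputable def oldExtIso (P : ProjectiveResolution X) (n : ℕ) :
    op (((_root_.Ext S (ModuleCat.{u} S) n).obj (op X)).obj M) ≅
      op (homShortComplex M P n).homology :=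
  (P.isoLeftDerivedObj ((linearYoneda S (ModuleCat.{u} S)).obj M).rightOp n) ≪≫
    (homShortComplex M P n).homologyOpIso

lemma subsingleton_oldExt_iff (n : ℕ) :
    Subsingleton (((_root_.Ext S (ModuleCat.{u} S) n).obj (op X)).obj M) ↔
      Subsingleton (Ext X M n) := by
  let P := projectiveResolution X
  have hm : n + 1 = (ComplexShape.down ℕ).prev n := ChainComplex.prev ℕ n |>.symm
  have e : ((_root_.Ext S (ModuleCat.{u} S) n).obj (op X)).obj M ≅
    (homShortComplex M P n).homology := (oldExtIso P n).unop.symm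
  rw [← ModuleCat.isZero_iff_subsingleton, e.isZero_iff, ← ShortComplex.exact_iff_isZero_homology,
    ShortComplex.moduleCat_exact_iff]
  constructor
  · intro h
    refine ⟨fun a b ↦ ?_⟩
    have key : ∀ a : Ext X M n, a = 0 := fun a ↦ by
      obtain ⟨f, hf, rfl⟩ := P.extMk_surjective a _ hm
      rw [extMk_eq_zero_iff_next]
      exact h f hf
    rw [key a, key b]
  · intro h (f : P.complex.X n ⟶ M) hf
    exact (extMk_eq_zero_iff_next P f _ hm hf).1 (Subsingleton.elim _ _)

lemma oldExt_map_injective (f : X ⟶ Y) (n : ℕ)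
    (h : ∀ a : Ext Y M n, (Ext.mk₀ f).comp a (zero_add n) = 0 → a = 0) :
    Function.Injective (((_root_.Ext S (ModuleCat.{u} S) n).map f.op).app M) := by
  let P := projectiveResolution X
  let Q := projectiveResolution Y
  have hm : n + 1 = (ComplexShape.down ℕ).prev n := ChainComplex.prev ℕ n |>.symm
  let F := ((linearYoneda S (ModuleCat.{u} S)).obj M).rightOp
  let φ : ProjectiveResolution.Hom P Q f :=
    { hom := ProjectiveResolution.lift f P Q
      hom_f_zero_comp_π_f_zero := by
        rw [← HomologicalComplex.comp_f, ProjectiveResolution.lift_commutes,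
          HomologicalComplex.comp_f] }
  let ψ := (HomologicalComplex.shortComplexFunctor _ _ n).map
    ((F.mapHomologicalComplex _).map φ.hom)
  let τ : homShortComplex M Q n ⟶ homShortComplex M P n := ShortComplex.unopMap ψ
  have hτ : Mono (ShortComplex.homologyMap τ) := by
    refine mono_homologyMap_of_forall _ ?_
    intro (x : Q.complex.X n ⟶ M) hx ⟨(y : P.complex.X _ ⟶ M), hy⟩
    refine (extMk_eq_zero_iff_next Q x _ hm hx).1 (h _ ?_)
    refine (ProjectiveResolution.mk₀_comp_extMk x _ hm hx φ).trans ?_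
    exact (extMk_eq_zero_iff_next P (φ.hom.f n ≫ x) _ hm _).2 ⟨y, hy⟩
  have h₁ : Epi (ShortComplex.homologyMap ψ) := by
    have := ShortComplex.homologyOpIso_hom_naturality τ
    rw [← Iso.eq_comp_inv] at this
    change ShortComplex.homologyMap ψ = _ at this
    have h' : Epi (ShortComplex.homologyMap τ).op := inferInstance
    rw [this]
    exact epi_comp' (epi_comp' (@IsIso.epi_of_iso _ _ _ _ _ (Iso.isIso_hom _)) h')
      (@IsIso.epi_of_iso _ _ _ _ _ (Iso.isIso_inv _))
  have h₂ : Epi ((F.leftDerived n).map f) := by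
    rw [Functor.leftDerived_map_eq F n f φ.hom φ.hom_comp_π]
    exact epi_comp' inferInstance (epi_comp' h₁ inferInstance)
  have h₃ : Mono ((F.leftDerived n).map f).unop := inferInstance
  exact (ModuleCat.mono_iff_injective _).1 h₃
end

end LocalCohomology
section LocalCohomologyVanishing

open CategoryTheory Abelian Opposite

variable {S : Type u} [CommRing S]

/-- The evaluation at `M` of the diagram whose colimit is `Hⁱ_𝔪(M)`. -/
noncomputable def localCohomologyDiagramObj (𝔪 : Ideal S) (i : ℕ) (M : ModuleCat.{u} S) :
    ℕᵒᵖᵒᵖ ⥤ ModuleCat.{u} S :=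
  localCohomology.diagram (localCohomology.idealPowersDiagram 𝔪) i ⋙ (evaluation _ _).obj M

instance (R : Type u) [Ring R] :
    Limits.PreservesFilteredColimitsOfSize.{0, 0} (forget (ModuleCat.{u} R)) :=
  Limits.preservesFilteredColimitsOfSize_shrink.{0, u, 0, u} _

/-- `Hⁱ_𝔪(M)` is the colimit of the modules `Extⁱ(S ⧸ 𝔪 ^ t, M)`. -/
noncomputable def localCohomologyObjIso (𝔪 : Ideal S) (i : ℕ) (M : ModuleCat.{u} S) :
    (localCohomology 𝔪 i).obj M ≅ Limits.colimit (localCohomologyDiagramObj 𝔪 i M) :=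
  Limits.colimitObjIsoColimitCompEvaluation _ _

lemma subsingleton_colimit_iff (𝔪 : Ideal S) (i : ℕ) (M : ModuleCat.{u} S) :
    Subsingleton ((localCohomology 𝔪 i).obj M) ↔
      Subsingleton (Limits.colimit (localCohomologyDiagramObj 𝔪 i M) : ModuleCat.{u} S) := by
  rw [← ModuleCat.isZero_iff_subsingleton, ← ModuleCat.isZero_iff_subsingleton,
    (localCohomologyObjIso 𝔪 i M).isZero_iff]

lemma HasRegSeq.subsingleton_localCohomology {𝔪 I : Ideal S} {n : ℕ} (h : HasRegSeq 𝔪 n I)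
    {i : ℕ} (hi : i < n) : Subsingleton ((localCohomology 𝔪 i).obj (cyclic I)) := by
  rw [subsingleton_colimit_iff]
  have key : ∀ x : (Limits.colimit (localCohomologyDiagramObj 𝔪 i (cyclic I)) : ModuleCat.{u} S),
      x = 0 := by
    intro x
    obtain ⟨j, y, rfl⟩ := Limits.Concrete.colimit_exists_rep _ x
    have : Subsingleton ((localCohomologyDiagramObj 𝔪 i (cyclic I)).obj j) := by
      refine (subsingleton_oldExt_iff i).2 (h.extVanishBelow (t := j.unop.unop) ?_ i hi)
      exact (Ideal.annihilator_quotient (I := 𝔪 ^ j.unop.unop)).ge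
    rw [Subsingleton.elim y 0, map_zero]
  exact ⟨fun a b ↦ (key a).trans (key b).symm⟩

lemma precomp_injective_of_surjective {𝔪 : Ideal S} {n t : ℕ} {M N N' : ModuleCat.{u} S}
    (hM : ∀ K : ModuleCat.{u} S, 𝔪 ^ t ≤ Module.annihilator S K → ExtVanishBelow K M n)
    (f : N ⟶ N') (hf : Function.Surjective f) (hN : 𝔪 ^ t ≤ Module.annihilator S N)
    (a : Ext N' M n) (ha : (Ext.mk₀ f).comp a (zero_add n) = 0) : a = 0 := by
  have : Epi f := (ModuleCat.epi_iff_surjective f).2 hf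
  obtain _ | n := n
  · obtain ⟨g, rfl⟩ := Ext.homEquiv₀.symm.surjective a
    change (Ext.mk₀ f).comp (Ext.mk₀ g) _ = 0 at ha
    rw [Ext.mk₀_comp_mk₀, Ext.mk₀_eq_zero_iff, ← Limits.comp_zero (f := f),
      cancel_epi] at ha
    change Ext.mk₀ g = 0
    rw [ha, Ext.mk₀_zero]
  · let C := f.hom.shortComplexKer
    have hC : C.ShortExact := LinearMap.shortExact_shortComplexKer hf
    obtain ⟨b, rfl⟩ := Ext.contravariant_sequence_exact₃ hC M a ha (n₀ := n) (add_comm 1 n)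
    have : Subsingleton (Ext C.X₁ M n) := by
      refine hM _ ?_ n n.lt_succ_self
      intro x hx
      rw [Module.mem_annihilator]
      intro m
      exact Subtype.ext (Module.mem_annihilator.1 (hN hx) m.1)
    rw [Subsingleton.elim b 0, Ext.comp_zero]

lemma hasRegSeq_of_subsingleton_localCohomology [IsNoetherianRing S] {𝔪 I : Ideal S} {n : ℕ}
    (h : ∀ i < n, Subsingleton ((localCohomology 𝔪 i).obj (cyclic I))) : HasRegSeq 𝔪 n I := by
  induction n with
  | zero => trivial
  | succ n ih =>
    have hn := ih fun i hi ↦ h i (by omega)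
    have hvan : ExtVanishBelow (cyclic 𝔪) (cyclic I) n :=
      hn.extVanishBelow (t := 1) (by simp [Ideal.annihilator_quotient])
    refine hasRegSeq_of_extVanishBelow fun i hi ↦ ?_
    obtain hi | rfl := Nat.lt_succ_iff_lt_or_eq.1 hi
    · exact hvan i hi
    have hcol := (subsingleton_colimit_iff 𝔪 i (cyclic I)).1 (h i i.lt_succ_self)
    rw [← pow_one 𝔪]
    refine (subsingleton_oldExt_iff i).1 ?_
    let D := localCohomologyDiagramObj 𝔪 i (cyclic I)
    change Subsingleton (D.obj (op (op 1)))
    refine ⟨fun a b ↦ ?_⟩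
    obtain ⟨j, f, g, hfg⟩ := Limits.Concrete.colimit_exists_of_rep_eq D a b (Subsingleton.elim _ _)
    obtain rfl : f = g := Subsingleton.elim _ _
    refine oldExt_map_injective (M := cyclic I)
      ((localCohomology.ringModIdeals (localCohomology.idealPowersDiagram 𝔪)).map f.unop) i ?_ hfg
    refine precomp_injective_of_surjective (𝔪 := 𝔪) (t := j.unop.unop)
      (fun K hK ↦ hn.extVanishBelow hK) _ ?_ ?_
    · intro x
      obtain ⟨y, rfl⟩ := Submodule.Quotient.mk_surjective _ x
      exact ⟨Submodule.Quotient.mk y, rfl⟩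
    · exact (Ideal.annihilator_quotient (I := 𝔪 ^ j.unop.unop)).ge

end LocalCohomologyVanishing
section TensorProduct

open scoped TensorProduct
variable {k A B R : Type u} [Field k] [CommRing A] [CommRing B] [CommRing R] [Algebra k A]
  [Algebra k B] [Algebra k R] {f : A →ₐ[k] R} {g : B →ₐ[k] R}

lemma productMap_bijective_swap (h : Function.Bijective (Algebra.TensorProduct.productMap f g)) :
    Function.Bijective (Algebra.TensorProduct.productMap g f) := by
  have : Algebra.TensorProduct.productMap g f =
      (Algebra.TensorProduct.productMap f g).comp (Algebra.TensorProduct.comm k B A).toAlgHom := by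
    ext <;> simp
  rw [this]
  exact h.comp (Algebra.TensorProduct.comm k B A).bijective

/-- A basis of `B` whose `Sum.inl` part lies in `J`, the other coordinates vanishing on `J`. -/
lemma exists_basis_adapted (J : Submodule k B) :
    ∃ (ι κ : Type u) (b : Module.Basis (ι ⊕ κ) k B),
      (∀ i, b (Sum.inl i) ∈ J) ∧ ∀ y ∈ J, ∀ i, b.repr y (Sum.inr i) = 0 := by
  obtain ⟨C, hC⟩ := J.exists_isCompl
  refine ⟨_, _, ((Module.Basis.ofVectorSpace k J).prod (Module.Basis.ofVectorSpace k C)).map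
    (J.prodEquivOfIsCompl C hC), fun i ↦ by simp, fun y hy i ↦ ?_⟩
  have : (J.prodEquivOfIsCompl C hC).symm y = (⟨y, hy⟩, 0) := by
    rw [LinearEquiv.symm_apply_eq]; simp
  simp [this]

lemma exists_coordinates (h : Function.Bijective (Algebra.TensorProduct.productMap f g))
    (J : Ideal B) : ∃ (ι κ : Type u) (b : ι ⊕ κ → B) (c : R →+ (ι ⊕ κ →₀ A)),
      (∀ i, b (Sum.inl i) ∈ J) ∧ (∀ a r i, c (f a * r) i = a * c r i) ∧
      (∀ a, ∀ y ∈ J, ∀ i, c (f a * g y) (Sum.inr i) = 0) ∧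
      ∀ r, r = (c r).sum fun i a ↦ f a * g (b i) := by
  obtain ⟨ι, κ, b, hb, hJ⟩ := exists_basis_adapted (J.restrictScalars k)
  let e : A ⊗[k] B ≃ₐ[k] R := AlgEquiv.ofBijective _ h
  have he : ∀ a y, e (a ⊗ₜ y) = f a * g y := fun a y ↦ by simp [e]
  have he' : ∀ a y, e.symm (f a * g y) = a ⊗ₜ y := fun a y ↦ by rw [← he, e.symm_apply_apply]
  let β := Algebra.TensorProduct.basis A b
  refine ⟨ι, κ, b, β.repr.toAddMonoidHom.comp (e.symm : R →+ A ⊗[k] B), hb, ?_, ?_, ?_⟩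
  · intro a r i
    have : e.symm (f a * r) = a • e.symm r := by
      rw [map_mul, ← mul_one (f a), ← map_one g, he', Algebra.smul_def]; rfl
    simp [this]
  · intro a y hy i
    simp [he', β, hJ y hy]
  · intro r
    apply e.symm.injective
    conv_lhs => rw [← β.linearCombination_repr (e.symm r)]
    simp [Finsupp.linearCombination_apply, map_finsuppSum, he', β, TensorProduct.smul_tmul']

/-- Membership in `IR + JR` and in `JR` is detected by coordinates. -/
lemma exists_coordinates_mem (h : Function.Bijective (Algebra.TensorProduct.productMap f g))
    (J : Ideal B) : ∃ (ι κ : Type u) (b : ι ⊕ κ → B) (c : R →+ (ι ⊕ κ →₀ A)),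
      (∀ i, b (Sum.inl i) ∈ J) ∧ (∀ a r i, c (f a * r) i = a * c r i) ∧
      (∀ r, r = (c r).sum fun i a ↦ f a * g (b i)) ∧
      (∀ (I : Ideal A), ∀ r ∈ I.map f, ∀ i, c r i ∈ I) ∧
      ∀ r ∈ J.map g, ∀ i, c r (Sum.inr i) = 0 := by
  obtain ⟨ι, κ, b, c, hb, hc, hJ, hsum⟩ := exists_coordinates h J
  refine ⟨ι, κ, b, c, hb, hc, hsum, fun I r hr i ↦ ?_, fun r hr i ↦ ?_⟩
  · refine Submodule.span_induction (p := fun r _ ↦ ∀ t i, c (t * r) i ∈ I)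
      ?_ (by simp) ?_ ?_ hr 1 i |> fun h ↦ by simpa using h
    · rintro _ ⟨a, ha, rfl⟩ t i
      rw [mul_comm]
      erw [hc]
      exact I.mul_mem_right _ ha
    · intro x y _ _ hx hy t i
      rw [mul_add, map_add, Finsupp.add_apply]
      exact I.add_mem (hx t i) (hy t i)
    · intro s x _ hx t i
      rw [smul_eq_mul, ← mul_assoc]
      exact hx _ i
  · refine Submodule.span_induction (p := fun r _ ↦ ∀ t i, c (t * r) (Sum.inr i) = 0)
      ?_ (by simp) ?_ ?_ hr 1 i |> fun h ↦ by simpa using h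
    · rintro _ ⟨y, hy, rfl⟩ t i
      rw [hsum t, Finsupp.sum, Finset.sum_mul, map_sum, Finsupp.finsetSum_apply]
      refine Finset.sum_eq_zero fun j _ ↦ ?_
      change c (f _ * g (b j) * g y) _ = 0
      rw [mul_assoc, ← map_mul]
      exact hJ _ _ (J.mul_mem_left _ hy) i
    · intro x y _ _ hx hy t i
      rw [mul_add, map_add, Finsupp.add_apply, hx, hy, add_zero]
    · intro s x _ hx t i
      rw [smul_eq_mul, ← mul_assoc]
      exact hx _ i

lemma map_inf_map_eq_mul (h : Function.Bijective (Algebra.TensorProduct.productMap f g))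
    (I : Ideal A) (J : Ideal B) : I.map f ⊓ J.map g = I.map f * J.map g := by
  refine le_antisymm (fun r ⟨hI, hJ⟩ ↦ ?_) Ideal.mul_le_inf
  obtain ⟨ι, κ, b, c, hb, -, hsum, hcI, hcJ⟩ := exists_coordinates_mem h J
  rw [hsum r]
  refine Ideal.sum_mem _ fun i hi ↦ ?_
  obtain i | i := i
  · exact Ideal.mul_mem_mul (Ideal.mem_map_of_mem _ (hcI I r hI _)) (Ideal.mem_map_of_mem _ (hb i))
  · simp [hcJ r hJ i]

lemma mem_sup_of_mul_mem (h : Function.Bijective (Algebra.TensorProduct.productMap f g))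
    {I : Ideal A} (J : Ideal B) {x : A} (hx : ∀ a, x * a ∈ I → a ∈ I) {r : R}
    (hr : f x * r ∈ I.map f ⊔ J.map g) : r ∈ I.map f ⊔ J.map g := by
  obtain ⟨ι, κ, b, c, hb, hc, hsum, hcI, hcJ⟩ := exists_coordinates_mem h J
  obtain ⟨u, hu, v, hv, huv⟩ := Submodule.mem_sup.1 hr
  rw [hsum r]
  refine Ideal.sum_mem _ fun i hi ↦ ?_
  obtain i | i := i
  · exact Ideal.mul_mem_left _ _ (le_sup_right (a := I.map f) (Ideal.mem_map_of_mem _ (hb i)))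
  · refine Ideal.mul_mem_right _ _ (le_sup_left (b := J.map g) (Ideal.mem_map_of_mem _ (hx _ ?_)))
    rw [← hc, ← huv, map_add, Finsupp.add_apply, hcJ v hv, add_zero]
    exact hcI I u hu _

lemma HasRegSeq.sup_map (h : Function.Bijective (Algebra.TensorProduct.productMap f g))
    {𝔪 : Ideal A} {𝔫 : Ideal B} {𝔯 : Ideal R} (hm : 𝔪.map f ≤ 𝔯) (hn : 𝔫.map g ≤ 𝔯)
    {I : Ideal A} {J : Ideal B} {p q : ℕ} (hI : HasRegSeq 𝔪 p I) (hJ : HasRegSeq 𝔫 q J) :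
    HasRegSeq 𝔯 (p + q) (I.map f ⊔ J.map g) := by
  induction p generalizing I with
  | zero =>
    rw [zero_add]
    induction q generalizing J with
    | zero => trivial
    | succ q ih =>
      obtain ⟨y, hy, hreg, hJ⟩ := hJ
      refine ⟨g y, hn (Ideal.mem_map_of_mem _ hy), fun r hr ↦ ?_, ?_⟩
      · rw [sup_comm] at hr ⊢
        exact mem_sup_of_mul_mem (productMap_bijective_swap h) I hreg hr
      · simpa [Ideal.map_sup, Ideal.map_span, sup_assoc] using ih hJ
  | succ p ih =>
    obtain ⟨x, hx, hreg, hI⟩ := hI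
    rw [Nat.add_right_comm]
    refine ⟨f x, hm (Ideal.mem_map_of_mem _ hx), fun r hr ↦ mem_sup_of_mul_mem h J hreg hr, ?_⟩
    rw [sup_right_comm]
    simpa [Ideal.map_sup, Ideal.map_span] using ih hI

end TensorProduct
section Dimension

variable {S : Type u} [CommRing S] {𝔪 I : Ideal S} {n : ℕ}

lemma HasRegSeq.le_ringKrullDim (h : HasRegSeq 𝔪 n I) (hI : I ≤ 𝔪) (hm : 𝔪 ≠ ⊤) :
    (n : WithBot ℕ∞) ≤ ringKrullDim (S ⧸ I) := by
  induction n generalizing I with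
  | zero =>
    have : Nontrivial (S ⧸ I) := Ideal.Quotient.nontrivial_iff.2 fun h ↦ hm (top_le_iff.1 (h ▸ hI))
    simpa using ringKrullDim_nonneg_of_nontrivial
  | succ n ih =>
    obtain ⟨x, hx, hreg, h⟩ := h
    have hle : I ⊔ Ideal.span {x} ≤ 𝔪 := sup_le hI ((Ideal.span_singleton_le_iff_mem _).2 hx)
    have hsurj := Ideal.Quotient.factor_surjective (S := I) (T := I ⊔ Ideal.span {x}) le_sup_left
    refine le_trans ?_ (ringKrullDim_succ_le_of_surjective _ hsurj
      (r := Ideal.Quotient.mk I x) ?_ ?_)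
    · push_cast
      gcongr
      exact ih h hle
    · rw [mem_nonZeroDivisors_iff_right]
      intro y hy
      obtain ⟨y, rfl⟩ := Ideal.Quotient.mk_surjective y
      rw [mul_comm, ← map_mul, Ideal.Quotient.eq_zero_iff_mem] at hy
      exact Ideal.Quotient.eq_zero_iff_mem.2 (hreg y hy)
    · rw [Ideal.Quotient.factor_mk, Ideal.Quotient.eq_zero_iff_mem]
      exact le_sup_right (a := I) (Ideal.mem_span_singleton_self x)

lemma HasRegSeq.succ_le_ringKrullDim [IsDomain S] (h : HasRegSeq 𝔪 n I) (hI : I ≤ 𝔪) (hm : 𝔪 ≠ ⊤)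
    (h0 : I ≠ ⊥) : ((n + 1 : ℕ) : WithBot ℕ∞) ≤ ringKrullDim S := by
  obtain ⟨x, hx, hx0⟩ := Submodule.exists_mem_ne_zero_of_ne_bot h0
  refine le_trans ?_ (ringKrullDim_succ_le_of_surjective (Ideal.Quotient.mk I)
    Ideal.Quotient.mk_surjective (mem_nonZeroDivisors_of_ne_zero hx0)
    (Ideal.Quotient.eq_zero_iff_mem.2 hx))
  push_cast
  gcongr
  exact h.le_ringKrullDim hI hm

end Dimension

section Polynomial

variable {k : Type} [Field k] {σ : Type}

lemma maxHomIdeal_ne_top : maxHomIdeal k σ ≠ ⊤ := by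
  rw [Ne, Ideal.eq_top_iff_one, maxHomIdeal, ← Set.image_univ, mem_ideal_span_X_image]
  intro h
  obtain ⟨i, -, hi⟩ := h 0 (by simp)
  exact hi rfl

lemma IsHomogeneousIdeal.le_maxHomIdeal {I : Ideal (MvPolynomial σ k)}
    (h : IsHomogeneousIdeal k I) (hI : I ≠ ⊤) : I ≤ maxHomIdeal k σ := by
  intro f hf
  rw [maxHomIdeal, ← Set.image_univ, mem_ideal_span_X_image]
  intro m hm
  by_contra! hm0
  obtain rfl : m = 0 := Finsupp.ext fun i ↦ by simpa using hm0 i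
  have h0 := h f hf 0
  rw [homogeneousComponent_zero] at h0
  exact hI (Ideal.eq_top_of_isUnit_mem _ h0 ((mem_support_iff.1 hm).isUnit.map C))

lemma hasRegSeq_variables (s d i : ℕ) (h : d + i = s) :
    HasRegSeq (maxHomIdeal k (Fin s)) d (Ideal.span (X '' {j : Fin s | j.val < i})) := by
  induction d generalizing i with
  | zero => trivial
  | succ d ih =>
    have hi : i < s := by omega
    refine ⟨X ⟨i, hi⟩, Ideal.subset_span ⟨_, rfl⟩, fun f hf ↦ ?_, ?_⟩
    · rw [mem_ideal_span_X_image] at hf ⊢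
      intro m hm
      obtain ⟨j, hj, hmj⟩ := hf (Finsupp.single ⟨i, hi⟩ 1 + m)
        (by rw [mem_support_iff, coeff_X_mul]; exact mem_support_iff.1 hm)
      refine ⟨j, hj, ?_⟩
      have hne : (⟨i, hi⟩ : Fin s) ≠ j := by
        rintro rfl
        exact lt_irrefl i hj
      simpa [Finsupp.single_apply, hne] using hmj
    · convert ih (i + 1) (by omega) using 1
      rw [← Ideal.span_union, ← Set.image_singleton, ← Set.image_union]
      congr 2
      ext j
      simp [Fin.ext_iff, Nat.le_iff_lt_or_eq, or_comm]

lemma hasRegSeq_bot (s : ℕ) : HasRegSeq (maxHomIdeal k (Fin s)) s ⊥ := by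
  simpa using hasRegSeq_variables (k := k) s s 0 rfl

lemma ringKrullDim_mvPolynomial [Finite σ] :
    ringKrullDim (MvPolynomial σ k) = Nat.card σ := by
  rw [ringKrullDim_of_isNoetherianRing]
  simp

lemma hasRegSeq_depthQuot [Finite σ] (Q : Ideal (MvPolynomial σ k)) :
    HasRegSeq (maxHomIdeal k σ) (depthQuot k Q) Q := by
  refine hasRegSeq_of_subsingleton_localCohomology fun i hi ↦ ?_
  exact not_nontrivial_iff_subsingleton.1 (Nat.notMem_of_lt_sInf hi)

lemma HasRegSeq.le_depthQuot [Finite σ] {Q : Ideal (MvPolynomial σ k)} {n : ℕ}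
    (h : HasRegSeq (maxHomIdeal k σ) n Q) (hQ : Q ≤ maxHomIdeal k σ) (h0 : Q ≠ ⊥) :
    n ≤ depthQuot k Q := by
  refine le_csInf ?_ fun i hi ↦ ?_
  · by_contra hne
    rw [Set.not_nonempty_iff_eq_empty, Set.eq_empty_iff_forall_notMem] at hne
    have hreg : HasRegSeq (maxHomIdeal k σ) (Nat.card σ) Q :=
      hasRegSeq_of_subsingleton_localCohomology fun i _ ↦ not_nontrivial_iff_subsingleton.1 (hne i)
    have := hreg.succ_le_ringKrullDim hQ maxHomIdeal_ne_top h0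
    rw [ringKrullDim_mvPolynomial] at this
    norm_cast at this
    omega
  · by_contra! hlt
    exact not_subsingleton_iff_nontrivial.2 hi (h.subsingleton_localCohomology hlt)

lemma depthQuot_lt {Q : Ideal (MvPolynomial σ k)} [Finite σ] (hQ : Q ≤ maxHomIdeal k σ)
    (h0 : Q ≠ ⊥) : depthQuot k Q < Nat.card σ := by
  have := (hasRegSeq_depthQuot Q).succ_le_ringKrullDim hQ maxHomIdeal_ne_top h0
  rw [ringKrullDim_mvPolynomial] at this
  exact_mod_cast this

lemma productMap_rename_bijective (r s : ℕ) :
    Function.Bijective (Algebra.TensorProduct.productMap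
      (rename Sum.inl : PA k r →ₐ[k] PR k r s) (rename Sum.inr : PB k s →ₐ[k] PR k r s)) := by
  let e : PR k r s →ₐ[k] TensorProduct k (PA k r) (PB k s) :=
    aeval (Sum.elim (fun i ↦ TensorProduct.tmul k (X i) 1) fun j ↦ TensorProduct.tmul k 1 (X j))
  refine (AlgEquiv.ofAlgHom (Algebra.TensorProduct.productMap
      (rename Sum.inl : PA k r →ₐ[k] PR k r s) (rename Sum.inr : PB k s →ₐ[k] PR k r s))
    e ?_ ?_).bijective
  · ext i
    obtain i | i := i <;> simp [e]
  · ext i <;> simp [e]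

end Polynomial

section PowerSum

variable {S : Type} [CommRing S] (I J : Ideal S)

/-- The partial sum `∑_{j ≤ i} I^(n-j) J^j` of the binomial expansion of `(I + J)^n`. -/
def partialPowerSum (n i : ℕ) : Ideal S := ∑ j ∈ Finset.range (i + 1), I ^ (n - j) * J ^ j

lemma partialPowerSum_self (n : ℕ) : partialPowerSum I J n n = (I + J) ^ n := by
  refine le_antisymm ?_ ?_
  · rw [partialPowerSum, Ideal.sum_eq_sup]
    refine Finset.sup_le fun j hj ↦ ?_
    have hj : j ≤ n := Nat.lt_succ_iff.1 (Finset.mem_range.1 hj)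
    calc I ^ (n - j) * J ^ j ≤ (I + J) ^ (n - j) * (I + J) ^ j :=
          Ideal.mul_mono (Ideal.pow_right_mono le_sup_left _) (Ideal.pow_right_mono le_sup_right _)
      _ = (I + J) ^ n := by rw [← pow_add, Nat.sub_add_cancel hj]
  · rw [add_comm, add_pow, partialPowerSum, Ideal.sum_eq_sup, Ideal.sum_eq_sup]
    refine Finset.sup_mono_fun fun j _ ↦ ?_
    rw [mul_comm (J ^ j)]
    exact Ideal.mul_le_left

lemma partialPowerSum_zero (n : ℕ) : partialPowerSum I J n 0 = I ^ n := by
  simp [partialPowerSum]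

lemma partialPowerSum_succ (n i : ℕ) :
    partialPowerSum I J n (i + 1) = partialPowerSum I J n i ⊔ I ^ (n - (i + 1)) * J ^ (i + 1) :=
  Finset.sum_range_succ _ _

lemma partialPowerSum_inf {n i : ℕ} (hi : i < n)
    (h : ∀ a b, I ^ a ⊓ J ^ b = I ^ a * J ^ b) :
    partialPowerSum I J n i ⊓ I ^ (n - (i + 1)) * J ^ (i + 1) = I ^ (n - i) * J ^ (i + 1) := by
  refine le_antisymm ?_ (le_inf ?_ ?_)
  · rw [← h (n - i) (i + 1)]
    refine inf_le_inf ?_ Ideal.mul_le_right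
    rw [partialPowerSum, Ideal.sum_eq_sup]
    refine Finset.sup_le fun j hj ↦ Ideal.mul_le_left.trans (Ideal.pow_le_pow_right ?_)
    have := Finset.mem_range.1 hj
    omega
  · rw [partialPowerSum, Finset.sum_range_succ]
    exact (Ideal.mul_mono_right (Ideal.pow_le_pow_right i.le_succ)).trans le_sup_right
  · exact Ideal.mul_mono_left (Ideal.pow_le_pow_right (by omega))

lemma HasRegSeq.add_pow {𝔪 : Ideal S} [IsNoetherianRing S] {n v : ℕ}
    (h : ∀ a b, I ^ a ⊓ J ^ b = I ^ a * J ^ b) (hI : HasRegSeq 𝔪 v (I ^ n))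
    (hJ : ∀ i < n, HasRegSeq 𝔪 v (I ^ (n - (i + 1)) * J ^ (i + 1)))
    (hIJ : ∀ i < n, HasRegSeq 𝔪 (v + 1) (I ^ (n - i) * J ^ (i + 1))) :
    HasRegSeq 𝔪 v ((I + J) ^ n) := by
  rw [← partialPowerSum_self]
  suffices ∀ i ≤ n, HasRegSeq 𝔪 v (partialPowerSum I J n i) from this n le_rfl
  intro i hi
  induction i with
  | zero => rwa [partialPowerSum_zero]
  | succ i ih =>
    rw [partialPowerSum_succ]
    refine HasRegSeq.sup ?_ (ih (by omega)) (hJ i hi)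
    rw [partialPowerSum_inf I J hi h]
    exact hIJ i hi

end PowerSum

section Extension

variable {k : Type} [Field k] {r s : ℕ} {I : Ideal (PA k r)} {J : Ideal (PB k s)} {p q : ℕ}

lemma map_rename_maxHomIdeal_le {σ τ : Type} (f : σ → τ) :
    (maxHomIdeal k σ).map (rename f : MvPolynomial σ k →ₐ[k] MvPolynomial τ k) ≤
      maxHomIdeal k τ := by
  rw [maxHomIdeal, Ideal.map_span, Ideal.span_le]
  rintro _ ⟨_, ⟨i, rfl⟩, rfl⟩
  exact Ideal.subset_span ⟨f i, (rename_X f i).symm⟩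

lemma extA_ne_bot (hI : I ≠ ⊥) : extA (s := s) k I ≠ ⊥ := by
  rw [extA, Ne, Ideal.map_eq_bot_iff_of_injective (rename_injective _ Sum.inl_injective)]
  exact hI

lemma HasRegSeq.extA_sup_extB (hI : HasRegSeq (maxHomIdeal k (Fin r)) p I)
    (hJ : HasRegSeq (maxHomIdeal k (Fin s)) q J) :
    HasRegSeq (maxHomIdeal k (Fin r ⊕ Fin s)) (p + q) (extA k I ⊔ extB k J) :=
  hI.sup_map (productMap_rename_bijective r s) (map_rename_maxHomIdeal_le _)
    (map_rename_maxHomIdeal_le _) hJ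

lemma HasRegSeq.extA (hI : HasRegSeq (maxHomIdeal k (Fin r)) p I) :
    HasRegSeq (maxHomIdeal k (Fin r ⊕ Fin s)) (p + s) (extA k I) := by
  have := hI.extA_sup_extB (hasRegSeq_bot (k := k) s)
  rwa [extB, Ideal.map_bot, sup_bot_eq] at this

lemma HasRegSeq.extB (hJ : HasRegSeq (maxHomIdeal k (Fin s)) q J) :
    HasRegSeq (maxHomIdeal k (Fin r ⊕ Fin s)) (r + q) (extB k J) := by
  have := (hasRegSeq_bot (k := k) r).extA_sup_extB hJ
  rwa [PaperHTT.extA, Ideal.map_bot, bot_sup_eq] at this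

lemma extA_pow (a : ℕ) : extA (s := s) k (I ^ a) = extA k I ^ a := Ideal.map_pow _ _ _

lemma extB_pow (b : ℕ) : extB (r := r) k (J ^ b) = extB k J ^ b := Ideal.map_pow _ _ _

lemma extA_inf_extB : extA k I ⊓ extB k J = extA k I * extB k J :=
  map_inf_map_eq_mul (productMap_rename_bijective r s) I J

lemma hasRegSeq_extA_mul_extB (hI0 : I ≠ ⊥) (hI : I ≤ maxHomIdeal k (Fin r)) (hJ0 : J ≠ ⊥)
    (hJ : J ≤ maxHomIdeal k (Fin s)) :
    HasRegSeq (maxHomIdeal k (Fin r ⊕ Fin s)) (depthQuot k I + depthQuot k J + 1)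
      (extA k I * extB k J) := by
  have hr := depthQuot_lt hI hI0
  have hs := depthQuot_lt hJ hJ0
  simp only [Nat.card_eq_fintype_card, Fintype.card_fin] at hr hs
  have hI' := hasRegSeq_depthQuot I
  have hJ' := hasRegSeq_depthQuot J
  rw [← extA_inf_extB]
  exact HasRegSeq.inf (hI'.extA_sup_extB hJ') (hI'.extA.mono (by omega)) (hJ'.extB.mono (by omega))

end Extension

end PaperHTT

open PaperHTT in
/-- Theorem 2.4(i): for `n ≥ 1`,
`depth R/(I+J)^n ≥ min {depth A/I^(n-i) + depth B/J^i + 1, depth A/I^(n-j+1) + depth B/J^j}`,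
the minimum taken over `1 ≤ i ≤ n-1` and `1 ≤ j ≤ n`. -/
theorem depth_quot_power_sum_ge
    (k : Type) [Field k] (r s : ℕ)
    (I : Ideal (PA k r)) (J : Ideal (PB k s))
    (hI0 : I ≠ ⊥) (hI1 : I ≠ ⊤) (hIh : IsHomogeneousIdeal k I)
    (hJ0 : J ≠ ⊥) (hJ1 : J ≠ ⊤) (hJh : IsHomogeneousIdeal k J)
    (n : ℕ) (hn : 1 ≤ n) :
    sInf {v : ℕ |
        (∃ i, 1 ≤ i ∧ i ≤ n - 1 ∧
          v = depthQuot k (I ^ (n - i)) + depthQuot k (J ^ i) + 1) ∨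
        (∃ j, 1 ≤ j ∧ j ≤ n ∧
          v = depthQuot k (I ^ (n - j + 1)) + depthQuot k (J ^ j))} ≤
      depthQuot k ((sumIJ k I J) ^ n) := by
  generalize hv : sInf {v : ℕ | _} = v
  have hmI := hIh.le_maxHomIdeal hI1
  have hmJ := hJh.le_maxHomIdeal hJ1
  have hIa : ∀ a, a ≠ 0 → I ^ a ≤ maxHomIdeal k (Fin r) :=
    fun a ha ↦ (Ideal.pow_le_self ha).trans hmI
  have hJb : ∀ b, b ≠ 0 → J ^ b ≤ maxHomIdeal k (Fin s) :=
    fun b hb ↦ (Ideal.pow_le_self hb).trans hmJ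
  have hle₁ : ∀ i, 1 ≤ i → i ≤ n - 1 →
      v ≤ depthQuot k (I ^ (n - i)) + depthQuot k (J ^ i) + 1 :=
    fun i h₁ h₂ ↦ hv ▸ Nat.sInf_le (Or.inl ⟨i, h₁, h₂, rfl⟩)
  have hle₂ : ∀ j, 1 ≤ j → j ≤ n →
      v ≤ depthQuot k (I ^ (n - j + 1)) + depthQuot k (J ^ j) :=
    fun j h₁ h₂ ↦ hv ▸ Nat.sInf_le (Or.inr ⟨j, h₁, h₂, rfl⟩)
  have hprod : ∀ a b, a ≠ 0 → b ≠ 0 → HasRegSeq (maxHomIdeal k (Fin r ⊕ Fin s))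
      (depthQuot k (I ^ a) + depthQuot k (J ^ b) + 1) (extA k I ^ a * extB k J ^ b) := by
    intro a b ha hb
    rw [← extA_pow, ← extB_pow]
    exact hasRegSeq_extA_mul_extB (pow_ne_zero a hI0) (hIa a ha) (pow_ne_zero b hJ0) (hJb b hb)
  have hcard : ∀ m, Nat.card (Fin m) = m := fun m ↦ by simp
  refine HasRegSeq.le_depthQuot (HasRegSeq.add_pow _ _ ?_ ?_ ?_ ?_) ?_ ?_
  · intro a b
    rw [← extA_pow, ← extB_pow, extA_inf_extB]
  · rw [← extA_pow]
    refine (hasRegSeq_depthQuot (I ^ n)).extA.mono ?_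
    have h₁ := hle₂ 1 le_rfl hn
    have h₂ := depthQuot_lt (hJb 1 one_ne_zero) (pow_ne_zero 1 hJ0)
    rw [Nat.sub_add_cancel hn] at h₁
    rw [hcard] at h₂
    omega
  · intro i hi
    obtain hi' | rfl := (Nat.succ_le_iff.2 hi).lt_or_eq
    · exact (hprod _ _ (by omega) (by omega)).mono (hle₁ _ (by omega) (by omega))
    · rw [Nat.sub_self, pow_zero, one_mul, ← extB_pow]
      refine (hasRegSeq_depthQuot _).extB.mono ?_
      have h₁ := hle₂ (i + 1) hn le_rfl
      have h₂ := depthQuot_lt (hIa 1 one_ne_zero) (pow_ne_zero 1 hI0)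
      rw [Nat.sub_self, zero_add] at h₁
      rw [hcard] at h₂
      omega
  · intro i hi
    have h₁ := hle₂ (i + 1) (by omega) hi
    rw [show n - (i + 1) + 1 = n - i by omega] at h₁
    exact (hprod _ _ (by omega) (by omega)).mono (by omega)
  · refine (Ideal.pow_le_self (by omega)).trans (sup_le ?_ ?_)
    · exact (Ideal.map_mono hmI).trans (map_rename_maxHomIdeal_le _)
    · exact (Ideal.map_mono hmJ).trans (map_rename_maxHomIdeal_le _)
  · refine pow_ne_zero n fun h ↦ extA_ne_bot (s := s) hI0 ?_
    exact le_bot_iff.1 (le_sup_left.trans h.le)
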